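/- Let G = (V,E,w) be a weighted connected graph, let S ⊆ V be nonempty, and let ψ = max_{v∈V} dist_G(v, S). Then for every x ∈ S and every real l ≥ 0, the induced subgraph G(C_S(l, x)) is connected and radius(G(C_S(l, x)), x) ≤ ψ + 2l. -/

import Mathlib

open scoped Classical

structure WGraph (V : Type) (E : Type) where
  ends : E → V × V
  w : E → ℝ
  w_pos : ∀ e, 0 < w e

namespace WGraph

variable {V E : Type}

/-- The length of an edge is the reciprocal of its weight. -/
noncomputable def len (G : WGraph V E) (e : E) : ℝ := 1 / G.w e

/-- A walk in a multigraph, recorded as a sequence of edge traversals. -/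
inductive Walk (G : WGraph V E) : V → V → Type
  | nil (v : V) : Walk G v v
  | cons (u v x : V) (e : E)
      (h : G.ends e = (u, v) ∨ G.ends e = (v, u))
      (p : Walk G v x) : Walk G u x

/-- The length of a walk: the sum of the lengths of its edges. -/
noncomputable def Walk.length {G : WGraph V E} : ∀ {u v : V}, G.Walk u v → ℝ
  | _, _, .nil _ => 0
  | _, _, .cons _ _ _ e _ p => G.len e + Walk.length p

/-- The list of vertices visited by a walk. -/
def Walk.support {G : WGraph V E} : ∀ {u v : V}, G.Walk u v → List V
  | _, _, .nil v => [v]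
  | _, _, .cons u _ _ _ _ p => u :: Walk.support p

def Connected (G : WGraph V E) : Prop := ∀ u v : V, Nonempty (G.Walk u v)

/-- Shortest-path distance. -/
noncomputable def dist (G : WGraph V E) (u v : V) : ℝ :=
  sInf {l | ∃ p : G.Walk u v, p.length = l}

/-- Shortest-path distance inside the subgraph induced on `A`. -/
noncomputable def distOn (G : WGraph V E) (A : Set V) (u v : V) : ℝ :=
  sInf {l | ∃ p : G.Walk u v, (∀ z ∈ p.support, z ∈ A) ∧ p.length = l}

/-- The distance from a vertex to a set of vertices. -/
noncomputable def distToSet (G : WGraph V E) (u : V) (S : Set V) : ℝ :=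
  sInf {l | ∃ s ∈ S, G.dist u s = l}

/-- The distance from a vertex to a set, within the subgraph induced on `A`. -/
noncomputable def distToSetOn (G : WGraph V E) (A : Set V) (u : V) (S : Set V) : ℝ :=
  sInf {l | ∃ s ∈ S, G.distOn A u s = l}

/-- radius(G,x): the smallest `r` such that every vertex is within distance `r` of `x`. -/
noncomputable def radius (G : WGraph V E) (x : V) : ℝ :=
  sInf {r | ∀ v : V, G.dist x v ≤ r}

/-- The radius of the subgraph induced on `A`, about `x`. -/
noncomputable def radiusOn (G : WGraph V E) (A : Set V) (x : V) : ℝ :=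
  sInf {r | ∀ v ∈ A, G.distOn A x v ≤ r}

/-- The subgraph induced on `A` is connected. -/
def ConnectedOn (G : WGraph V E) (A : Set V) : Prop :=
  ∀ u ∈ A, ∀ v ∈ A, ∃ p : G.Walk u v, ∀ z ∈ p.support, z ∈ A

/-- The spanning subgraph with edge set `T`. -/
def restrictE (G : WGraph V E) (T : Set E) : WGraph V T where
  ends e := G.ends e.1
  w e := G.w e.1
  w_pos e := G.w_pos e.1

/-- `T` is the edge set of a spanning tree of `G` (a subgraph of `G`). -/
def IsSpanningTree [Fintype V] (G : WGraph V E) (T : Finset E) : Prop :=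
  (G.restrictE (T : Set E)).Connected ∧ T.card + 1 = Fintype.card V

/-- stretch_T(u,v) = dist_T(u,v)/d(u,v) for the edge e = (u,v). -/
noncomputable def stretch (G : WGraph V E) (T : Finset E) (e : E) : ℝ :=
  (G.restrictE (T : Set E)).dist (G.ends e).1 (G.ends e).2 / G.len e

/-- The average stretch over all edges. -/
noncomputable def avestretch [Fintype E] (G : WGraph V E) (T : Finset E) : ℝ :=
  (∑ e : E, G.stretch T e) / (Fintype.card E : ℝ)

/-- The Alon–Karp–Peleg–West stretch: dist_T(u,v)/dist_G(u,v). -/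
noncomputable def stretchAKPW (G : WGraph V E) (T : Finset E) (e : E) : ℝ :=
  (G.restrictE (T : Set E)).dist (G.ends e).1 (G.ends e).2 /
    G.dist (G.ends e).1 (G.ends e).2

/-- The average AKPW stretch over all edges. -/
noncomputable def avestretchAKPW [Fintype E] (G : WGraph V E) (T : Finset E) : ℝ :=
  (∑ e : E, G.stretchAKPW T e) / (Fintype.card E : ℝ)

/-- The ball of radius `r` around `x`. -/
def ball (G : WGraph V E) (r : ℝ) (x : V) : Set V := {v | G.dist x v ≤ r}

/-- The ball shell of radius `r` around `x`. -/
def ballShell (G : WGraph V E) (r : ℝ) (x : V) : Set V :=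
  {u | u ∉ G.ball r x ∧ ∃ e : E, ∃ z ∈ G.ball r x,
    (G.ends e = (u, z) ∨ G.ends e = (z, u)) ∧ G.dist x u = G.dist x z + G.len e}

/-- The set of edges with exactly one endpoint in `S`. -/
def bdry (G : WGraph V E) (S : Set V) : Set E :=
  {e | ((G.ends e).1 ∈ S ∧ (G.ends e).2 ∉ S) ∨ ((G.ends e).1 ∉ S ∧ (G.ends e).2 ∈ S)}

/-- The set of edges with both endpoints in `S`. -/
def edgesIn (G : WGraph V E) (S : Set V) : Set E :=
  {e | (G.ends e).1 ∈ S ∧ (G.ends e).2 ∈ S}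

/-- The set of edges with one endpoint in `S` and the other in `T`. -/
def edgesBetween (G : WGraph V E) (S T : Set V) : Set E :=
  {e | ((G.ends e).1 ∈ S ∧ (G.ends e).2 ∈ T) ∨ ((G.ends e).1 ∈ T ∧ (G.ends e).2 ∈ S)}

/-- vol(S): the number of edges with at least one endpoint in `S`. -/
noncomputable def volV (G : WGraph V E) (S : Set V) : ℕ :=
  {e : E | (G.ends e).1 ∈ S ∨ (G.ends e).2 ∈ S}.ncard

/-- cost(F): the sum of the weights of the edges in `F`. -/
noncomputable def cost [Fintype E] (G : WGraph V E) (F : Set E) : ℝ :=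
  ∑ e : E, F.indicator G.w e

/-- A star-decomposition of `G` with center `x0`, parts `P i`, anchors `x i`,
`y i ∈ P 0`, and bridge edges `b i` for `i ≠ 0`. -/
structure IsStarDecomp (G : WGraph V E) (x0 : V) (k : ℕ)
    (P : Fin (k + 1) → Set V) (x y : Fin (k + 1) → V)
    (b : Fin (k + 1) → E) : Prop where
  disj : ∀ i j, i ≠ j → Disjoint (P i) (P j)
  cover : ⋃ i, P i = Set.univ
  center : x0 ∈ P 0
  conn : ∀ i, G.ConnectedOn (P i)
  anchor : ∀ i, x i ∈ P i
  x0eq : x 0 = x0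
  bridge : ∀ i, i ≠ 0 → y i ∈ P 0 ∧
    (G.ends (b i) = (x i, y i) ∨ G.ends (b i) = (y i, x i))

/-- A (δ,ε)-star-decomposition. -/
def IsStarDecompDE (G : WGraph V E) (x0 : V) (δ ε : ℝ) (k : ℕ)
    (P : Fin (k + 1) → Set V) (x y : Fin (k + 1) → V)
    (b : Fin (k + 1) → E) : Prop :=
  G.IsStarDecomp x0 k P x y b ∧
  δ * G.radius x0 ≤ G.radiusOn (P 0) x0 ∧
  G.radiusOn (P 0) x0 ≤ (1 - δ) * G.radius x0 ∧
  ∀ i, i ≠ 0 →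
    G.radiusOn (P 0) x0 + G.len (b i) + G.radiusOn (P i) (x i) ≤
      (1 + ε) * G.radius x0

/-- A concentric system in `G` (indexed by nonnegative radii). -/
structure IsConcentric (G : WGraph V E) (L : ℝ → Set V) : Prop where
  nonempty : (L 0).Nonempty
  mono : ∀ r r' : ℝ, 0 ≤ r → r < r' → L r ⊆ L r'
  closed : ∀ r : ℝ, 0 ≤ r → ∀ e : E,
    ((G.ends e).1 ∈ L r → (G.ends e).2 ∈ L (r + G.len e)) ∧
    ((G.ends e).2 ∈ L r → (G.ends e).1 ∈ L (r + G.len e))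

/-- The total length of the traversals of a walk that are not forward
(with respect to `S`). -/
noncomputable def Walk.coneCost {G : WGraph V E} (S : Set V) :
    ∀ {u v : V}, G.Walk u v → ℝ
  | _, _, .nil _ => 0
  | _, _, .cons a c _ e _ p =>
      (if G.distToSet a S + G.len e = G.distToSet c S then 0 else G.len e) +
        Walk.coneCost S p

/-- The cone of width `l` around `v` induced by `S`. -/
def cone (G : WGraph V E) (S : Set V) (l : ℝ) (v : V) : Set V :=
  {u | ∃ p : G.Walk v u, Walk.coneCost S p ≤ l}

/-- `coneCost` computed within the subgraph induced on `A`. -/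
noncomputable def Walk.coneCostOn {G : WGraph V E} (A S : Set V) :
    ∀ {u v : V}, G.Walk u v → ℝ
  | _, _, .nil _ => 0
  | _, _, .cons a c _ e _ p =>
      (if G.distToSetOn A a S + G.len e = G.distToSetOn A c S then 0 else G.len e) +
        Walk.coneCostOn A S p

/-- The cone of width `l` around `v` induced by `S`, computed in the subgraph
induced on `A`. -/
def coneOn (G : WGraph V E) (A S : Set V) (l : ℝ) (v : V) : Set V :=
  {u | ∃ p : G.Walk v u, (∀ z ∈ p.support, z ∈ A) ∧ Walk.coneCostOn A S p ≤ l}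

end WGraph

namespace WGraph

variable {V E : Type} {G : WGraph V E}

theorem len_pos (G : WGraph V E) (e : E) : 0 < G.len e :=
  one_div_pos.mpr (G.w_pos e)

namespace Walk

theorem length_nonneg {u v : V} (p : G.Walk u v) : 0 ≤ p.length := by
  induction p with
  | nil v => simp [length]
  | cons u v x e h p ih => simpa [length] using add_nonneg (G.len_pos e).le ih

theorem coneCost_nonneg (S : Set V) {u v : V} (p : G.Walk u v) : 0 ≤ coneCost S p := by
  induction p with
  | nil v => simp [coneCost]
  | cons u v x e h p ih =>
    rw [coneCost]
    have := G.len_pos e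
    split_ifs <;> linarith

theorem start_mem_support {u v : V} (p : G.Walk u v) : u ∈ p.support := by
  cases p <;> simp [support]

theorem exists_append {A : Set V} {a b c : V} (p : G.Walk a b) (q : G.Walk b c)
    (hp : ∀ z ∈ p.support, z ∈ A) (hq : ∀ z ∈ q.support, z ∈ A) :
    ∃ r : G.Walk a c, ∀ z ∈ r.support, z ∈ A := by
  induction p with
  | nil v => exact ⟨q, hq⟩
  | cons u v x e h p ih =>
    simp only [support, List.mem_cons, forall_eq_or_imp] at hp
    obtain ⟨r, hr⟩ := ih q hp.2 hq
    exact ⟨.cons u v c e h r, by simpa [support] using ⟨hp.1, hr⟩⟩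

theorem exists_reverse {A : Set V} {a b : V} (p : G.Walk a b)
    (hp : ∀ z ∈ p.support, z ∈ A) : ∃ r : G.Walk b a, ∀ z ∈ r.support, z ∈ A := by
  induction p with
  | nil v => exact ⟨.nil v, hp⟩
  | cons u v x e h p ih =>
    simp only [support, List.mem_cons, forall_eq_or_imp] at hp
    obtain ⟨r, hr⟩ := ih hp.2
    refine exists_append r (.cons v u u e h.symm (.nil u)) hr ?_
    simpa [support] using ⟨hp.2 v p.start_mem_support, hp.1⟩

theorem exists_coneCost_le (S : Set V) {u v z : V} (p : G.Walk u v) (hz : z ∈ p.support) :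
    ∃ q : G.Walk u z, coneCost S q ≤ coneCost S p := by
  have nil_case {a b : V} (p : G.Walk a b) :
      ∃ q : G.Walk a a, coneCost S q ≤ coneCost S p :=
    ⟨.nil a, by simpa [coneCost] using p.coneCost_nonneg S⟩
  induction p with
  | nil v =>
    obtain rfl : z = v := by simpa [support] using hz
    exact nil_case _
  | cons u v x e h p ih =>
    rcases List.mem_cons.mp hz with rfl | hz
    · exact nil_case _
    · obtain ⟨q, hq⟩ := ih hz
      exact ⟨.cons u v z e h q, by simpa [coneCost] using hq⟩

theorem support_subset_cone {S : Set V} {l : ℝ} {x u : V} (p : G.Walk x u)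
    (hp : coneCost S p ≤ l) : ∀ z ∈ p.support, z ∈ G.cone S l x := fun _ hz =>
  let ⟨q, hq⟩ := p.exists_coneCost_le S hz
  ⟨q, hq.trans hp⟩

end Walk

theorem dist_le_length {u v : V} (p : G.Walk u v) : G.dist u v ≤ p.length :=
  csInf_le ⟨0, by rintro _ ⟨q, rfl⟩; exact q.length_nonneg⟩ ⟨p, rfl⟩

theorem dist_nonneg (G : WGraph V E) (u v : V) : 0 ≤ G.dist u v :=
  Real.sInf_nonneg (by rintro _ ⟨q, rfl⟩; exact q.length_nonneg)

theorem distOn_le_length {A : Set V} {u v : V} (p : G.Walk u v) (hp : ∀ z ∈ p.support, z ∈ A) :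
    G.distOn A u v ≤ p.length :=
  csInf_le ⟨0, by rintro _ ⟨q, -, rfl⟩; exact q.length_nonneg⟩ ⟨p, hp, rfl⟩

theorem distOn_nonneg (G : WGraph V E) (A : Set V) (u v : V) : 0 ≤ G.distOn A u v :=
  Real.sInf_nonneg (by rintro _ ⟨q, -, rfl⟩; exact q.length_nonneg)

theorem distToSet_nonneg (G : WGraph V E) (u : V) (S : Set V) : 0 ≤ G.distToSet u S :=
  Real.sInf_nonneg (by rintro _ ⟨s, -, rfl⟩; exact G.dist_nonneg u s)

theorem dist_le_len_add (hG : G.Connected) {a c : V} {e : E}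
    (h : G.ends e = (a, c) ∨ G.ends e = (c, a)) (s : V) :
    G.dist a s ≤ G.len e + G.dist c s := by
  rw [← sub_le_iff_le_add']
  obtain ⟨p⟩ := hG c s
  refine le_csInf ⟨_, p, rfl⟩ ?_
  rintro _ ⟨q, rfl⟩
  rw [sub_le_iff_le_add']
  exact dist_le_length (.cons a c s e h q)

theorem distToSet_le_len_add (hG : G.Connected) {S : Set V} (hS : S.Nonempty) {a c : V} {e : E}
    (h : G.ends e = (a, c) ∨ G.ends e = (c, a)) :
    G.distToSet a S ≤ G.len e + G.distToSet c S := by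
  rw [← sub_le_iff_le_add']
  obtain ⟨s, hs⟩ := hS
  refine le_csInf ⟨_, s, hs, rfl⟩ ?_
  rintro _ ⟨t, ht, rfl⟩
  rw [sub_le_iff_le_add']
  have : G.distToSet a S ≤ G.dist a t :=
    csInf_le ⟨0, by rintro _ ⟨r, -, rfl⟩; exact G.dist_nonneg a r⟩ ⟨t, ht, rfl⟩
  exact this.trans (dist_le_len_add hG h t)

/-- Along a walk, a forward edge raises the distance to `S` by its length, and any other edge
lowers it by at most its length. -/
theorem Walk.distToSet_add_length_le (hG : G.Connected) {S : Set V} (hS : S.Nonempty) {u v : V}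
    (p : G.Walk u v) :
    G.distToSet u S + p.length ≤ G.distToSet v S + 2 * Walk.coneCost S p := by
  induction p with
  | nil v => simp [Walk.length, Walk.coneCost]
  | cons u v x e h p ih =>
    rw [Walk.length, Walk.coneCost]
    have := distToSet_le_len_add hG hS h
    split_ifs <;> linarith

theorem connectedOn_cone (G : WGraph V E) (S : Set V) (l : ℝ) (x : V) :
    G.ConnectedOn (G.cone S l x) := by
  rintro u ⟨p, hp⟩ v ⟨q, hq⟩
  obtain ⟨r, hr⟩ := p.exists_reverse (p.support_subset_cone hp)
  exact r.exists_append q hr (q.support_subset_cone hq)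

theorem distOn_cone_le (hG : G.Connected) {S : Set V} (hS : S.Nonempty) {l : ℝ} {x u : V}
    (hu : u ∈ G.cone S l x) :
    G.distOn (G.cone S l x) x u ≤ G.distToSet u S + 2 * l := by
  obtain ⟨p, hp⟩ := hu
  have h₁ := distOn_le_length p (p.support_subset_cone hp)
  have h₂ := p.distToSet_add_length_le hG hS
  have h₃ := G.distToSet_nonneg x S
  linarith

theorem radiusOn_le {A : Set V} {x : V} {r : ℝ} (hx : x ∈ A)
    (hr : ∀ v ∈ A, G.distOn A x v ≤ r) : G.radiusOn A x ≤ r :=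
  csInf_le ⟨0, fun _ ht => (G.distOn_nonneg A x x).trans (ht x hx)⟩ hr

end WGraph

/-- Radius of cones: for `x ∈ S` and `l ≥ 0`, the induced
subgraph on `C_S(l,x)` is connected and has radius at most `ψ + 2l` about `x`,
where `ψ = max_{v∈V} dist_G(v,S)`. -/
theorem radius_of_cones (V E : Type) [Fintype V] [Fintype E] (G : WGraph V E) (hG : G.Connected)
    (S : Set V) (hS : S.Nonempty)
    (ψ : ℝ) (hψ : ψ = sSup (Set.range fun u => G.distToSet u S)) :
    ∀ x ∈ S, ∀ l : ℝ, 0 ≤ l →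
      G.ConnectedOn (G.cone S l x) ∧
      G.radiusOn (G.cone S l x) x ≤ ψ + 2 * l := by
  intro x _ l hl
  refine ⟨G.connectedOn_cone S l x, WGraph.radiusOn_le ⟨.nil x, hl⟩ fun u hu => ?_⟩
  have hu' : G.distToSet u S ≤ ψ := hψ ▸ le_csSup (Set.finite_range _).bddAbove ⟨u, rfl⟩
  linarith [WGraph.distOn_cone_le hG hS hu]
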